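/- arXiv:0812.3670 — 2 statements merged into one kernel-verified Lean document; each statement's English description precedes it below -/
import Mathlib

section
/- Let V5 be a 5-dimensional complex vector space and let L be a 2-dimensional subspace of the space of alternating bilinear forms on V5 such that every nonzero form in L has rank 4. Then there exists a unique 3-dimensional subspace U3 of V5 that is totally isotropic for every form in L. -/
open Module

theorem exists_pair_of_finrank_eq_two {K E : Type*} [Field K] [AddCommGroup E] [Module K E]
    {L : Submodule K E} (hL : finrank K L = 2) :
    ∃ x ∈ L, ∃ y ∈ L, (∀ s t : K, (s ≠ 0 ∨ t ≠ 0) → s • x + t • y ≠ 0) ∧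
      ∀ z ∈ L, ∃ s t : K, s • x + t • y = z := by
  have : Module.Finite K L := Module.finite_of_finrank_eq_succ hL
  let b := finBasisOfFinrankEq K L hL
  refine ⟨b 0, (b 0).2, b 1, (b 1).2, fun s t hst h0 => ?_, fun z hz => ?_⟩
  · have hli := Fintype.linearIndependent_iff.1 b.linearIndependent ![s, t]
      (Subtype.ext (by simpa [Fin.sum_univ_two] using h0))
    exact hst.elim (fun h => h (hli 0)) (fun h => h (hli 1))
  · have hsum := congrArg Subtype.val (b.sum_repr ⟨z, hz⟩)
    simp only [Fin.sum_univ_two, Submodule.coe_add, Submodule.coe_smul] at hsum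
    exact ⟨_, _, hsum⟩

theorem exists_relation_of_finrank_lt_three {K E : Type*} [Field K] [AddCommGroup E] [Module K E]
    {S : Submodule K E} [FiniteDimensional K S] (hS : finrank K S < 3) {x y z : E}
    (hx : x ∈ S) (hy : y ∈ S) (hz : z ∈ S) :
    ∃ r s t : K, r • x + s • y + t • z = 0 ∧ (r ≠ 0 ∨ s ≠ 0 ∨ t ≠ 0) := by
  have hf : ¬ LinearIndependent K ![(⟨x, hx⟩ : S), ⟨y, hy⟩, ⟨z, hz⟩] := fun hli => by
    have := hli.fintype_card_le_finrank
    rw [Fintype.card_fin] at this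
    omega
  obtain ⟨g, hg, i, hi⟩ := Fintype.not_linearIndependent_iff.1 hf
  refine ⟨g 0, g 1, g 2, ?_, ?_⟩
  · simpa [Fin.sum_univ_three] using congrArg Subtype.val hg
  · by_contra! hcon
    fin_cases i
    exacts [hi hcon.1, hi hcon.2.1, hi hcon.2.2]

section AlternatingPencil

variable {K V : Type*} [Field K] [AddCommGroup V] [Module K V]

theorem LinearMap.apply_eq_neg_apply_of_self {B : V →ₗ[K] V →ₗ[K] K} (hB : ∀ v, B v v = 0)
    (u v : V) : B u v = -B v u := by
  have h := hB (u + v)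
  simp only [map_add, LinearMap.add_apply, hB, zero_add, add_zero] at h
  exact eq_neg_of_add_eq_zero_right h

variable [FiniteDimensional K V]

theorem finrank_le_finrank_map_add_finrank_ker {V₂ : Type*} [AddCommGroup V₂] [Module K V₂]
    (f : V →ₗ[K] V₂) (P : Submodule K V) :
    finrank K P ≤ finrank K (P.map f) + finrank K (LinearMap.ker f) := by
  have h1 := (f.domRestrict P).finrank_range_add_finrank_ker
  have h2 : LinearMap.range (f.domRestrict P) = P.map f := by
    ext y
    simp
  have h3 : finrank K (LinearMap.ker (f.domRestrict P)) ≤ finrank K (LinearMap.ker f) := by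
    refine LinearMap.finrank_le_finrank_of_injective
      (f := (P.subtype ∘ₗ (LinearMap.ker (f.domRestrict P)).subtype).codRestrict
        (LinearMap.ker f) (fun x => LinearMap.mem_ker.1 x.2)) ?_
    intro x y hxy
    have hval := congrArg Subtype.val hxy
    exact Subtype.ext (Subtype.ext hval)
  rw [h2] at h1
  omega

theorem mem_range_of_apply_ker_eq_zero {B : V →ₗ[K] V →ₗ[K] K} (hB : ∀ v, B v v = 0)
    (hker : finrank K (LinearMap.ker B) = 1) {a : V} (ha : a ≠ 0) (hBa : B a = 0)
    {φ : V →ₗ[K] K} (hφ : φ a = 0) : φ ∈ LinearMap.range B := by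
  have hle : LinearMap.range B ≤ (Submodule.span K {a}).dualAnnihilator := by
    rintro _ ⟨v, rfl⟩
    rw [Submodule.mem_dualAnnihilator]
    intro w hw
    obtain ⟨r, rfl⟩ := Submodule.mem_span_singleton.1 hw
    rw [map_smul, LinearMap.apply_eq_neg_apply_of_self hB, hBa]
    simp
  have h1 := B.finrank_range_add_finrank_ker
  have h2 : finrank K (Submodule.span K {a}) +
      finrank K (Submodule.span K {a}).dualAnnihilator = finrank K V :=
    Subspace.finrank_add_finrank_dualAnnihilator_eq _
  rw [finrank_span_singleton ha] at h2
  rw [Submodule.eq_of_le_of_finrank_eq hle (by lia), Submodule.mem_dualAnnihilator]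
  intro w hw
  obtain ⟨r, rfl⟩ := Submodule.mem_span_singleton.1 hw
  simp [hφ]

theorem not_common_kernel_of_pencil [IsAlgClosed K] (hV : 1 < finrank K V)
    {A B : V →ₗ[K] V →ₗ[K] K} (hA : ∀ v, A v v = 0) (hB : ∀ v, B v v = 0)
    (hker : ∀ s t : K, (s ≠ 0 ∨ t ≠ 0) → finrank K (LinearMap.ker (s • A + t • B)) = 1)
    {a : V} (ha : a ≠ 0) (hAa : A a = 0) : B a ≠ 0 := by
  intro hBa
  obtain ⟨H, hH⟩ := Submodule.exists_isCompl (Submodule.span K {a})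
  have hkA : finrank K (LinearMap.ker A) = 1 := by
    have h := hker 1 0 (by simp)
    rwa [one_smul, zero_smul, add_zero] at h
  have hsurj : Function.Surjective (A.rangeRestrict.domRestrict H) := by
    rintro ⟨_, v, rfl⟩
    obtain ⟨y, hy, z, hz, rfl⟩ := Submodule.mem_sup.1 (hH.sup_eq_top ▸ Submodule.mem_top (x := v))
    obtain ⟨r, rfl⟩ := Submodule.mem_span_singleton.1 hy
    exact ⟨⟨z, hz⟩, Subtype.ext (by simp [hAa])⟩
  have hrange : ∀ v : H, (B ∘ₗ H.subtype) v ∈ LinearMap.range A := fun v =>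
    mem_range_of_apply_ker_eq_zero hA hkA ha hAa
      (by simp [LinearMap.apply_eq_neg_apply_of_self hB _ a, hBa])
  obtain ⟨h, hh⟩ := Module.projective_lifting_property (A.rangeRestrict.domRestrict H)
    ((B ∘ₗ H.subtype).codRestrict _ hrange) hsurj
  have hdim := Submodule.finrank_add_eq_of_isCompl hH
  rw [finrank_span_singleton ha] at hdim
  have : Nontrivial H := Module.nontrivial_of_finrank_pos (R := K) (by omega)
  obtain ⟨l, hl⟩ := Module.End.exists_eigenvalue h
  obtain ⟨x, hx⟩ := hl.exists_hasEigenvector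
  have hxl : l • A x = B x := by
    have h1 := congrArg Subtype.val (LinearMap.congr_fun hh x)
    simpa [hx.apply_eq_smul] using h1
  have hk := hker l (-1) (by simp)
  have hxk : (x : V) ∈ LinearMap.ker (l • A + (-1 : K) • B) := by simp [hxl]
  have hak : a ∈ LinearMap.ker (l • A + (-1 : K) • B) := by simp [hAa, hBa]
  rw [eq_span_singleton_of_mem_of_finrank_eq_one hk hak ha] at hxk
  exact hx.2 (Subtype.ext (Submodule.disjoint_def.1 hH.disjoint _ hxk x.2))

theorem smul_apply_ne_of_pencil (hV : finrank K V = 5)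
    {A B : V →ₗ[K] V →ₗ[K] K} (hA : ∀ v, A v v = 0) (hB : ∀ v, B v v = 0)
    (hker : ∀ s t : K, (s ≠ 0 ∨ t ≠ 0) → finrank K (LinearMap.ker (s • A + t • B)) = 1)
    {a c : V} (ha : a ≠ 0) (hc : c ∉ Submodule.span K {a}) (hAa : A a = 0) (hBc : B c = 0)
    (hAc : A c ≠ 0) (m : K) : B a ≠ m • A c := by
  intro hBa
  set W := Submodule.span K {a} ⊔ Submodule.span K {c} with hW
  have hWr : finrank K W = 2 := by
    rw [hW, Submodule.finrank_sup_span_singleton hc, finrank_span_singleton ha]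
  have hHr := (A c).finrank_range_add_finrank_ker
  have hH1 : finrank K (LinearMap.range (A c)) ≤ 1 := by
    simpa using (LinearMap.range (A c)).finrank_le
  obtain ⟨x, hxH, hxW⟩ : ∃ x, x ∈ LinearMap.ker (A c) ∧ x ∉ W := by
    by_contra! hcon
    have := Submodule.finrank_mono (show LinearMap.ker (A c) ≤ W from hcon)
    omega
  set P := W ⊔ Submodule.span K {x} with hP
  have hPr : finrank K P = 3 := by
    rw [hP, Submodule.finrank_sup_span_singleton hxW, hWr]
  have hPann : finrank K P + finrank K P.dualAnnihilator = finrank K V :=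
    Subspace.finrank_add_finrank_dualAnnihilator_eq P
  have hann : ∀ φ : V →ₗ[K] K, φ a = 0 → φ c = 0 → φ x = 0 → φ ∈ P.dualAnnihilator := by
    intro φ h1 h2 h3
    have : P ≤ LinearMap.ker φ := by
      simp [hP, hW, Submodule.span_singleton_le_iff_mem, h1, h2, h3]
    exact (Submodule.mem_dualAnnihilator φ).2 fun w hw => this hw
  have hcx : A c x = 0 := hxH
  have hAxc : A x c = 0 := by rw [LinearMap.apply_eq_neg_apply_of_self hA, hcx, neg_zero]
  have hAxa : A x a = 0 := by rw [LinearMap.apply_eq_neg_apply_of_self hA, hAa]; simp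
  have hBxc : B x c = 0 := by rw [LinearMap.apply_eq_neg_apply_of_self hB, hBc]; simp
  have hBxa : B x a = 0 := by rw [LinearMap.apply_eq_neg_apply_of_self hB, hBa]; simp [hcx]
  have hAca : A c a = 0 := by rw [LinearMap.apply_eq_neg_apply_of_self hA, hAa]; simp
  have hann2 : finrank K P.dualAnnihilator < 3 := by omega
  obtain ⟨s, t, r, hrel, hne⟩ := exists_relation_of_finrank_lt_three hann2
    (hann _ hAxa hAxc (hA x)) (hann _ hBxa hBxc (hB x)) (hann _ hAca (hA c) hcx)
  have hst : s ≠ 0 ∨ t ≠ 0 := by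
    by_contra! hcon
    obtain ⟨rfl, rfl⟩ := hcon
    rw [zero_smul, zero_smul, zero_add, zero_add] at hrel
    exact (smul_eq_zero.1 hrel).elim (by simpa using hne) hAc
  have hmap : P.map (s • A + t • B) ≤ Submodule.span K {A c} := by
    rw [Submodule.map_le_iff_le_comap]
    simp only [hP, hW, sup_le_iff, Submodule.span_singleton_le_iff_mem, Submodule.mem_comap,
      Submodule.mem_span_singleton]
    refine ⟨⟨⟨t * m, ?_⟩, ⟨s, ?_⟩⟩, ⟨-r, ?_⟩⟩
    · simp [hAa, hBa, mul_smul]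
    · simp [hBc]
    · simp only [LinearMap.add_apply, LinearMap.smul_apply, neg_smul]
      exact (eq_neg_of_add_eq_zero_left hrel).symm
  have h1 := finrank_le_finrank_map_add_finrank_ker (s • A + t • B) P
  have h2 := Submodule.finrank_mono hmap
  rw [finrank_span_singleton hAc] at h2
  have h3 := hker _ _ hst
  omega

theorem ker_le_and_map_eq_of_isotropic (hV : finrank K V = 5) {B : V →ₗ[K] V →ₗ[K] K}
    (hker : finrank K (LinearMap.ker B) = 1) {U : Submodule K V} (hU : finrank K U = 3)
    (hiso : ∀ u ∈ U, ∀ v ∈ U, B u v = 0) :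
    LinearMap.ker B ≤ U ∧ U.map B = U.dualAnnihilator := by
  have hle : U.map B ≤ U.dualAnnihilator := by
    rintro _ ⟨u, hu, rfl⟩
    exact (Submodule.mem_dualAnnihilator _).2 fun v hv => hiso u hu v hv
  have h1 : finrank K U + finrank K U.dualAnnihilator = finrank K V :=
    Subspace.finrank_add_finrank_dualAnnihilator_eq U
  have h2 : finrank K (U.map B) ≤ finrank K U.dualAnnihilator := Submodule.finrank_mono hle
  have h3 := finrank_le_finrank_map_add_finrank_ker B U
  have heq : finrank K (U.map B) = finrank K U.dualAnnihilator := by omega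
  refine ⟨?_, Submodule.eq_of_le_of_finrank_eq hle heq⟩
  have h4 := finrank_le_finrank_map_add_finrank_ker B (U ⊔ LinearMap.ker B)
  have h5 : (U ⊔ LinearMap.ker B).map B = U.map B := by
    rw [Submodule.map_sup, (LinearMap.le_ker_iff_map (f := B)).1 le_rfl, sup_bot_eq]
  rw [h5] at h4
  have h6 := Submodule.eq_of_le_of_finrank_le
    (le_sup_left : U ≤ U ⊔ LinearMap.ker B) (by omega)
  exact h6 ▸ le_sup_right

theorem existsUnique_isotropic_of_pencil [IsAlgClosed K] (hV : finrank K V = 5)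
    {A B : V →ₗ[K] V →ₗ[K] K} (hA : ∀ v, A v v = 0) (hB : ∀ v, B v v = 0)
    (hker : ∀ s t : K, (s ≠ 0 ∨ t ≠ 0) → finrank K (LinearMap.ker (s • A + t • B)) = 1) :
    ∃! U : Submodule K V, finrank K U = 3 ∧
      ∀ u ∈ U, ∀ v ∈ U, A u v = 0 ∧ B u v = 0 := by
  have hkA : finrank K (LinearMap.ker A) = 1 := by
    have h := hker 1 0 (by simp)
    rwa [one_smul, zero_smul, add_zero] at h
  have hkB : finrank K (LinearMap.ker B) = 1 := by
    have h := hker 0 1 (by simp)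
    rwa [one_smul, zero_smul, zero_add] at h
  obtain ⟨a, hAa, ha⟩ := Submodule.exists_mem_ne_zero_of_ne_bot
    (fun h => by rw [h, finrank_bot] at hkA; omega : LinearMap.ker A ≠ ⊥)
  obtain ⟨c, hBc, hc⟩ := Submodule.exists_mem_ne_zero_of_ne_bot
    (fun h => by rw [h, finrank_bot] at hkB; omega : LinearMap.ker B ≠ ⊥)
  have hkAa := eq_span_singleton_of_mem_of_finrank_eq_one hkA hAa ha
  rw [LinearMap.mem_ker] at hAa hBc
  have hBa : B a ≠ 0 := not_common_kernel_of_pencil (by omega) hA hB hker ha hAa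
  have hca : c ∉ Submodule.span K {a} := by
    intro h
    obtain ⟨r, rfl⟩ := Submodule.mem_span_singleton.1 h
    simp_all
  have hAc : A c ≠ 0 := fun h => hca (hkAa ▸ h)
  obtain ⟨b, hb⟩ := mem_range_of_apply_ker_eq_zero hA hkA ha hAa (φ := -B a) (by simp [hB])
  have hbW : b ∉ Submodule.span K {a} ⊔ Submodule.span K {c} := by
    intro h
    obtain ⟨y, hy, z, hz, rfl⟩ := Submodule.mem_sup.1 h
    obtain ⟨r, rfl⟩ := Submodule.mem_span_singleton.1 hy
    obtain ⟨s, rfl⟩ := Submodule.mem_span_singleton.1 hz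
    refine smul_apply_ne_of_pencil hV hA hB hker ha hca hAa hBc hAc (-s) ?_
    have : s • A c = -B a := by simpa [hAa] using hb
    ext v
    have hv := LinearMap.congr_fun this v
    simp only [LinearMap.smul_apply, LinearMap.neg_apply, smul_eq_mul, neg_mul] at hv ⊢
    rw [hv, neg_neg]
  set U := Submodule.span K {a} ⊔ Submodule.span K {c} ⊔ Submodule.span K {b} with hU
  have hUr : finrank K U = 3 := by
    rw [hU, Submodule.finrank_sup_span_singleton hbW, Submodule.finrank_sup_span_singleton hca,
      finrank_span_singleton ha]
  have hbc : A b c = 0 := by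
    rw [hb, LinearMap.neg_apply, LinearMap.apply_eq_neg_apply_of_self hB, hBc]; simp
  have hab : B a b = 0 := by
    rw [← neg_eq_zero, ← LinearMap.neg_apply, ← hb, hA]
  have hba : B b a = 0 := by rw [LinearMap.apply_eq_neg_apply_of_self hB, hab, neg_zero]
  have hcb : A c b = 0 := by rw [LinearMap.apply_eq_neg_apply_of_self hA, hbc, neg_zero]
  have hac (X : V →ₗ[K] V →ₗ[K] K) (hX : ∀ v, X v v = 0) (u v : V) (h : X u = 0) :
      X v u = 0 := by rw [LinearMap.apply_eq_neg_apply_of_self hX, h]; simp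
  refine ⟨U, ⟨hUr, ?_⟩, ?_⟩
  · intro u hu v hv
    simp only [hU, Submodule.mem_sup, Submodule.mem_span_singleton] at hu hv
    obtain ⟨_, ⟨_, ⟨p, rfl⟩, _, ⟨q, rfl⟩, rfl⟩, _, ⟨r, rfl⟩, rfl⟩ := hu
    obtain ⟨_, ⟨_, ⟨p', rfl⟩, _, ⟨q', rfl⟩, rfl⟩, _, ⟨r', rfl⟩, rfl⟩ := hv
    constructor
    · simp [hAa, hA, hbc, hcb, hac A hA a _ hAa]
    · simp [hBc, hB, hab, hba, hac B hB c _ hBc]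
  · rintro U' ⟨hU'r, hiso⟩
    obtain ⟨hA1, hA2⟩ := ker_le_and_map_eq_of_isotropic hV hkA hU'r
      fun u hu v hv => (hiso u hu v hv).1
    obtain ⟨hB1, hB2⟩ := ker_le_and_map_eq_of_isotropic hV hkB hU'r
      fun u hu v hv => (hiso u hu v hv).2
    have haU : a ∈ U' := hA1 hAa
    have hcU : c ∈ U' := hB1 hBc
    have hbU : b ∈ U' := by
      have h1 : A b ∈ U'.map A := by
        rw [hA2, ← hB2, hb]
        exact neg_mem (Submodule.mem_map_of_mem haU)
      obtain ⟨u, hu, hub⟩ := h1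
      have h2 : b - u ∈ U' := hA1 (by simp [hub])
      simpa using add_mem h2 hu
    refine (Submodule.eq_of_le_of_finrank_eq ?_ (by omega)).symm
    simp [hU, Submodule.span_singleton_le_iff_mem, haU, hcU, hbU]

end AlternatingPencil

/-- Let `V₅` be a 5-dimensional complex vector space and `L` a 2-dimensional space of
alternating bilinear forms on `V₅` all of whose nonzero members have rank 4.  Then there is a
unique 3-dimensional subspace `U₃ ⊂ V₅` totally isotropic for every form in `L`. -/
theorem stmt0 (V : Type*) [AddCommGroup V] [Module ℂ V] [FiniteDimensional ℂ V]
    (h5 : finrank ℂ V = 5)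
    (L : Submodule ℂ (V →ₗ[ℂ] V →ₗ[ℂ] ℂ))
    (halt : ∀ B ∈ L, ∀ v : V, B v v = 0)
    (hL : finrank ℂ L = 2)
    (hrank : ∀ B ∈ L, B ≠ 0 → finrank ℂ (LinearMap.range B) = 4) :
    ∃! U3 : Submodule ℂ V, finrank ℂ U3 = 3 ∧
      ∀ B ∈ L, ∀ u ∈ U3, ∀ v ∈ U3, B u v = 0 := by
  obtain ⟨A, hA, B, hB, hli, hspan⟩ := exists_pair_of_finrank_eq_two hL
  have hker : ∀ s t : ℂ, (s ≠ 0 ∨ t ≠ 0) → finrank ℂ (LinearMap.ker (s • A + t • B)) = 1 := by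
    intro s t hst
    have h1 := hrank _ (L.add_mem (L.smul_mem s hA) (L.smul_mem t hB)) (hli s t hst)
    have h2 := (s • A + t • B).finrank_range_add_finrank_ker
    omega
  have hiff : ∀ U : Submodule ℂ V, (∀ X ∈ L, ∀ u ∈ U, ∀ v ∈ U, X u v = 0) ↔
      ∀ u ∈ U, ∀ v ∈ U, A u v = 0 ∧ B u v = 0 := by
    refine fun U => ⟨fun h u hu v hv => ⟨h _ hA u hu v hv, h _ hB u hu v hv⟩, ?_⟩
    intro h X hX u hu v hv
    obtain ⟨s, t, rfl⟩ := hspan X hX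
    simp [h u hu v hv]
  simp only [hiff]
  exact existsUnique_isotropic_of_pencil h5 (halt _ hA) (halt _ hB) hker
end

section
/- Let U2 be 2-dimensional, U3 = Sym²(U2*), V5 = U2 ⊕ U3. There is a natural linear map Sym²(U2 ⊗ U3) → Λ²U2 ⊗ Λ²U3 sending (u⊗Q)·(v⊗P) to (u∧v)⊗(P∧Q). Consequently, if x = u∧v + u⊗Q − v⊗P + P∧Q with u,v ∈ U2 and P,Q ∈ U3 and u∧v ≠ 0, then the component P∧Q is determined by the components u∧v + u⊗Q − v⊗P; hence the projection forgetting the Λ²U3-component is generically injective on such decomposable tensors. -/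
open Module TensorProduct

open ExteriorAlgebra in
/-- The pairing `(u ⊗ Q, v ⊗ P) ↦ (u ∧ v) ⊗ (P ∧ Q)`. -/
noncomputable def wedgePairing (R M N : Type*) [CommRing R] [AddCommGroup M] [Module R M]
    [AddCommGroup N] [Module R N] :
    (M ⊗[R] N) →ₗ[R] (M ⊗[R] N) →ₗ[R] (ExteriorAlgebra R M ⊗[R] ExteriorAlgebra R N) :=
  TensorProduct.map₂ ((LinearMap.mul R (ExteriorAlgebra R M)).compl₁₂ (ι R) (ι R))
    ((LinearMap.mul R (ExteriorAlgebra R N)).compl₁₂ (ι R) (ι R)).flip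

namespace wedgePairing

open ExteriorAlgebra

variable {R M N : Type*} [CommRing R] [AddCommGroup M] [Module R M] [AddCommGroup N] [Module R N]

@[simp]
theorem tmul_tmul (u v : M) (P Q : N) :
    wedgePairing R M N (u ⊗ₜ Q) (v ⊗ₜ P) = (ι R u * ι R v) ⊗ₜ (ι R P * ι R Q) := by
  simp [wedgePairing]

theorem comm (x y : M ⊗[R] N) : wedgePairing R M N x y = wedgePairing R M N y x := by
  suffices h : wedgePairing R M N = (wedgePairing R M N).flip from
    LinearMap.congr_fun₂ h x y
  ext u Q v P
  have hM : ι R u * ι R v = -(ι R v * ι R u) := eq_neg_of_add_eq_zero_left (ι_add_mul_swap u v)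
  have hN : ι R P * ι R Q = -(ι R Q * ι R P) := eq_neg_of_add_eq_zero_left (ι_add_mul_swap P Q)
  simp [hM, hN, TensorProduct.neg_tmul, TensorProduct.tmul_neg]

theorem sub_tmul_self (u v : M) (P Q : N) :
    wedgePairing R M N (u ⊗ₜ Q - v ⊗ₜ P) (u ⊗ₜ Q - v ⊗ₜ P) =
      -(2 : R) • ((ι R u * ι R v) ⊗ₜ[R] (ι R P * ι R Q)) := by
  simp only [map_sub, LinearMap.sub_apply, comm (v ⊗ₜ[R] P) (u ⊗ₜ[R] Q), tmul_tmul,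
    ι_sq_zero, TensorProduct.zero_tmul]
  module

end wedgePairing

/-- There is a natural symmetric bilinear map `Sym²(U₂⊗U₃) → Λ²U₂ ⊗ Λ²U₃` sending
`(u⊗Q)·(v⊗P)` to `(u∧v)⊗(P∧Q)`; consequently for a decomposable tensor
`u∧v + u⊗Q − v⊗P + P∧Q ∈ Λ²(U₂⊕U₃)` with `u∧v ≠ 0`, the component `P∧Q` is determined by the
other two components. -/
theorem stmt4 (U2 U3 : Type*) [AddCommGroup U2] [Module ℂ U2] [AddCommGroup U3] [Module ℂ U3]
    [FiniteDimensional ℂ U2] [FiniteDimensional ℂ U3]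
    (h2 : finrank ℂ U2 = 2) (h3 : finrank ℂ U3 = 3) :
    (∃ f : (U2 ⊗[ℂ] U3) →ₗ[ℂ] (U2 ⊗[ℂ] U3) →ₗ[ℂ]
        (ExteriorAlgebra ℂ U2 ⊗[ℂ] ExteriorAlgebra ℂ U3),
      (∀ x y, f x y = f y x) ∧
      ∀ (u v : U2) (P Q : U3),
        f (u ⊗ₜ Q) (v ⊗ₜ P) =
          (ExteriorAlgebra.ι ℂ u * ExteriorAlgebra.ι ℂ v) ⊗ₜ
            (ExteriorAlgebra.ι ℂ P * ExteriorAlgebra.ι ℂ Q)) ∧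
    (∀ (u v u' v' : U2) (P Q P' Q' : U3),
      (ExteriorAlgebra.ι ℂ u * ExteriorAlgebra.ι ℂ v : ExteriorAlgebra ℂ U2) ≠ 0 →
      ExteriorAlgebra.ι ℂ u * ExteriorAlgebra.ι ℂ v
        = ExteriorAlgebra.ι ℂ u' * ExteriorAlgebra.ι ℂ v' →
      (u ⊗ₜ[ℂ] Q - v ⊗ₜ[ℂ] P : U2 ⊗[ℂ] U3) = u' ⊗ₜ[ℂ] Q' - v' ⊗ₜ[ℂ] P' →
      (ExteriorAlgebra.ι ℂ P * ExteriorAlgebra.ι ℂ Q : ExteriorAlgebra ℂ U3)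
        = ExteriorAlgebra.ι ℂ P' * ExteriorAlgebra.ι ℂ Q') := by
  refine ⟨⟨wedgePairing ℂ U2 U3, wedgePairing.comm, wedgePairing.tmul_tmul⟩, ?_⟩
  intro u v u' v' P Q P' Q' hne huv hmix
  have h := wedgePairing.sub_tmul_self (R := ℂ) u v P Q
  rw [hmix, wedgePairing.sub_tmul_self, ← huv] at h
  have h' := smul_right_injective _ (neg_ne_zero.mpr (two_ne_zero (α := ℂ))) h
  obtain ⟨φ, hφ⟩ := Module.Projective.exists_dual_ne_zero ℂ hne
  have key := congrArg (TensorProduct.lid ℂ _ ∘ φ.rTensor _) h'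
  simp only [Function.comp_apply, LinearMap.rTensor_tmul, TensorProduct.lid_tmul] at key
  exact (smul_right_injective _ hφ key).symm
end
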